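/- Let x be the horizontal component of the Peano curve. There exists a function L : [0,1] × ℝ → [0,1] such that for every t ∈ [0,1] the function z ↦ L_t^z := L(t,z) is Borel measurable, and for every bounded Borel-measurable g : ℝ → ℝ one has ∫_0^t g(x(s)) ds = ∫_ℝ g(z) L_t^z dz. In other words, x possesses a local time (density of its occupation measure) with respect to Lebesgue measure, and this local time attains values no greater than 1. -/

import Mathlib

open scoped BigOperators Classical
open Filter

noncomputable section

/-- The digit map `k n = 2 - n` on `{0,1,2}` (with truncated natural subtraction). -/
def peanoK : ℕ → ℕ := fun n => 2 - n

/-- The `m`-th (0-indexed) ternary digit of the horizontal component of the Peano curve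
evaluated at the point with ternary digits `d` (0-indexed, i.e. `t_j = d (j-1)`):
the `j`-th digit of `x(t)` is `k^[t_2 + t_4 + ⋯ + t_{2j-2}] (t_{2j-1})`. -/
def peanoXDigit (d : ℕ → Fin 3) (m : ℕ) : ℕ :=
  peanoK^[∑ i ∈ Finset.range m, (d (2 * i + 1) : ℕ)] (d (2 * m) : ℕ)

/-- `x : ℝ → ℝ` is (on `[0,1]`) the horizontal component of the Peano curve:
for every ternary expansion `t = Σ_j d_j 3^{-(j+1)}`, `x t` is given by the digit formula. -/
def IsPeanoX (x : ℝ → ℝ) : Prop :=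
  ∀ d : ℕ → Fin 3,
    x (∑' j : ℕ, (d j : ℝ) / 3 ^ (j + 1)) = ∑' m : ℕ, (peanoXDigit d m : ℝ) / 3 ^ (m + 1)

/-- The grid `cℤ + r = {cq + r : q ∈ ℤ}`. -/
def peanoGrid (c r : ℝ) : Set ℝ := {u : ℝ | ∃ q : ℤ, u = c * q + r}

/-- `lebTime x c r m` is the time `t_{m+1}(c,r)` of the Lebesgue partition `π(c,r)` for `x`
on `[0,1]` (values in `[0,1] ∪ {+∞}`, modelled in `EReal`; `sInf ∅ = ⊤ = +∞`). -/
def lebTime (x : ℝ → ℝ) (c r : ℝ) : ℕ → EReal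
  | 0 => sInf (Real.toEReal '' {t : ℝ | t ∈ Set.Icc (0 : ℝ) 1 ∧ x t ∈ peanoGrid c r})
  | m + 1 =>
    if lebTime x c r m = ⊤ then ⊤
    else
      sInf (Real.toEReal ''
        {t : ℝ | t ∈ Set.Icc ((lebTime x c r m).toReal) 1 ∧ x t ∈ peanoGrid c r ∧
          x t ≠ x ((lebTime x c r m).toReal)})

/-- `k(c,r,t) = min{m ∈ ℕ₊ : t_m(c,r) ≥ t}` (recall `t_m(c,r) = lebTime x c r (m-1)`). -/
def kIdx (x : ℝ → ℝ) (c r t : ℝ) : ℕ :=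
  sInf {m : ℕ | 1 ≤ m ∧ (t : EReal) ≤ lebTime x c r (m - 1)}

/-- `l(c,r,t) = max{m ∈ ℕ₊ : t_m(c,r) ≤ t}`. -/
def lIdx (x : ℝ → ℝ) (c r t : ℝ) : ℕ :=
  sSup {m : ℕ | 1 ≤ m ∧ lebTime x c r (m - 1) ≤ (t : EReal)}

/-- The quadratic variation `[x]_{s,t}^{c,r}` of `x` on `[s,t]` along the Lebesgue partition
`π(c,r)`: the sum over `m = k(c,r,s), …, l(c,r,t) - 1` of `(x(t_{m+1}) - x(t_m))²`. -/
def qvar (x : ℝ → ℝ) (c r s t : ℝ) : ℝ :=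
  ∑ m ∈ Finset.Ico (kIdx x c r s) (lIdx x c r t),
    (x ((lebTime x c r m).toReal) - x ((lebTime x c r (m - 1)).toReal)) ^ 2

/-- `[x]_t^{c,r} := [x]_{0,t}^{c,r}`. -/
def qvar0 (x : ℝ → ℝ) (c r t : ℝ) : ℝ := qvar x c r 0 t

/-- Digits of the horizontal component of the Peano curve, as elements of `Fin 3`. -/
def peanoXFinDigit (d : ℕ → Fin 3) (m : ℕ) : Fin 3 :=
  Fin.rev^[∑ i ∈ Finset.range m, (d (2 * i + 1) : ℕ)] (d (2 * m))

theorem coe_peanoXFinDigit (d : ℕ → Fin 3) (m : ℕ) :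
    (peanoXFinDigit d m : ℕ) = peanoXDigit d m := by
  have h : Function.Semiconj (fun a : Fin 3 => (a : ℕ)) Fin.rev peanoK := by
    intro a
    fin_cases a <;> rfl
  exact (h.iterate_right _) _

theorem IsPeanoX.apply_ofDigits {x : ℝ → ℝ} (hx : IsPeanoX x) (d : ℕ → Fin 3) :
    x (Real.ofDigits d) = Real.ofDigits (peanoXFinDigit d) := by
  have h := hx d
  simp only [← coe_peanoXFinDigit] at h
  simpa only [Real.ofDigits, Real.ofDigitsTerm, div_eq_mul_inv, Nat.cast_ofNat] using h

theorem continuous_peanoXFinDigit : Continuous peanoXFinDigit := by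
  refine continuous_pi fun m => ?_
  have hf : Continuous fun p : ℕ × Fin 3 => Fin.rev^[p.1] p.2 := continuous_of_discreteTopology
  have hs : Continuous fun d : ℕ → Fin 3 => ∑ i ∈ Finset.range m, (d (2 * i + 1) : ℕ) :=
    continuous_finsetSum _ fun i _ =>
      (continuous_of_discreteTopology (f := fun a : Fin 3 => (a : ℕ))).comp (continuous_apply _)
  exact hf.comp (hs.prodMk (continuous_apply (2 * m)))

theorem IsPeanoX.mem_Icc {x : ℝ → ℝ} (hx : IsPeanoX x) {s : ℝ} (hs : s ∈ Set.Icc (0 : ℝ) 1) :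
    x s ∈ Set.Icc (0 : ℝ) 1 := by
  obtain ⟨d, -, rfl⟩ := Real.ofDigits_SurjOn (b := 3) (by norm_num) hs
  rw [hx.apply_ofDigits]
  exact ⟨Real.ofDigits_nonneg _, Real.ofDigits_le_one _⟩

/-- The horizontal component of the Peano curve is continuous: it factors through the quotient map
sending a digit sequence to the real number it represents. -/
theorem IsPeanoX.continuousOn {x : ℝ → ℝ} (hx : IsPeanoX x) :
    ContinuousOn x (Set.Icc 0 1) := by
  rw [continuousOn_iff_isClosed]
  intro C hC
  have hcont : Continuous fun d : ℕ → Fin 3 => Real.ofDigits (peanoXFinDigit d) :=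
    Real.continuous_ofDigits.comp continuous_peanoXFinDigit
  refine ⟨Real.ofDigits '' ((fun d => Real.ofDigits (peanoXFinDigit d)) ⁻¹' C),
    ((hC.preimage hcont).isCompact.image Real.continuous_ofDigits).isClosed, ?_⟩
  ext s
  refine and_congr_left fun hs => ⟨fun hsC => ?_, ?_⟩
  · obtain ⟨d, -, rfl⟩ := Real.ofDigits_SurjOn (b := 3) (by norm_num) hs
    exact ⟨d, by simpa only [Set.mem_preimage, hx.apply_ofDigits] using hsC, rfl⟩
  · rintro ⟨d, hd, rfl⟩
    simpa only [Set.mem_preimage, hx.apply_ofDigits] using hd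

/-- The reflection of `[0,1]` if `b = 1`, the identity if `b = 0` or `b = 2`. -/
def peanoFlip (b : Fin 3) (u : ℝ) : ℝ := if b = 1 then 1 - u else u

theorem ofDigits_rev (e : ℕ → Fin 3) :
    Real.ofDigits (fun m => (e m).rev) = 1 - Real.ofDigits e := by
  rw [eq_sub_iff_add_eq, ← Real.ofDigits_const_last_eq_one 2]
  simp only [Real.ofDigits]
  rw [← Real.summable_ofDigitsTerm.tsum_add Real.summable_ofDigitsTerm]
  refine tsum_congr fun m => ?_
  simp only [Real.ofDigitsTerm, ← add_mul, ← Nat.cast_add]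
  congr 2
  have := (e m).isLt
  simp only [Fin.val_rev, Fin.val_last]
  omega

theorem ofDigits_rev_iterate (b : Fin 3) (e : ℕ → Fin 3) :
    Real.ofDigits (fun m => Fin.rev^[(b : ℕ)] (e m)) = peanoFlip b (Real.ofDigits e) := by
  fin_cases b
  · simp [peanoFlip]
  · simpa [peanoFlip] using ofDigits_rev e
  · simp [peanoFlip]

/-- Self-similarity of the horizontal component of the Peano curve. -/
theorem IsPeanoX.self_similar {x : ℝ → ℝ} (hx : IsPeanoX x) (a b : Fin 3) {s : ℝ}
    (hs : s ∈ Set.Icc (0 : ℝ) 1) :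
    x ((a + (b + s) / 3) / 3) = (a + peanoFlip b (x s)) / 3 := by
  obtain ⟨d, -, rfl⟩ := Real.ofDigits_SurjOn (b := 3) (by norm_num) hs
  let e : ℕ → Fin 3 := fun n => match n with
    | 0 => a
    | 1 => b
    | n + 2 => d n
  have he : Real.ofDigits e = (a + (b + Real.ofDigits d) / 3) / 3 := by
    rw [Real.ofDigits_eq_sum_add_ofDigits e 2]
    simp only [Finset.sum_range_succ, Finset.sum_range_zero, Real.ofDigitsTerm, e]
    push_cast
    ring
  have hshift : (fun m => peanoXFinDigit e (m + 1)) =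
      fun m => Fin.rev^[(b : ℕ)] (peanoXFinDigit d m) := by
    funext m
    rw [peanoXFinDigit, Finset.sum_range_succ', add_comm, Function.iterate_add_apply]
    rfl
  rw [← he, hx.apply_ofDigits, hx.apply_ofDigits, Real.ofDigits_eq_sum_add_ofDigits _ 1, hshift,
    ofDigits_rev_iterate]
  simp [Real.ofDigitsTerm, peanoXFinDigit, e]
  ring

/-- Splitting an integral over `[0,1]` into thirds. -/
theorem integral_unit_eq_sum_thirds {f : ℝ → ℂ} (hf : ContinuousOn f (Set.Icc 0 1)) :
    ∫ s in (0 : ℝ)..1, f s = (1 / 3 : ℝ) • ∑ a : Fin 3, ∫ s in (0 : ℝ)..1, f ((a + s) / 3) := by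
  have hint : ∀ k < 3, IntervalIntegrable f MeasureTheory.volume
      ((fun k : ℕ => (k : ℝ) / 3) k) ((fun k : ℕ => (k : ℝ) / 3) (k + 1)) := by
    intro k hk
    refine (hf.mono ?_).intervalIntegrable
    rw [Set.uIcc_of_le (by push_cast; linarith)]
    have : (k : ℝ) + 1 ≤ 3 := by exact_mod_cast hk
    exact Set.Icc_subset_Icc (by positivity) (by push_cast; linarith)
  have h := intervalIntegral.sum_integral_adjacent_intervals hint
  simp only [Nat.cast_zero, zero_div, Nat.cast_ofNat, div_self (three_ne_zero (α := ℝ))] at h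
  rw [← h, Finset.smul_sum, Finset.sum_range]
  refine Finset.sum_congr rfl fun a _ => ?_
  have h2 := intervalIntegral.integral_comp_mul_add (a := 0) (b := 1) f
    (c := (1 / 3 : ℝ)) (by norm_num) ((a : ℝ) / 3)
  have h3 : ∀ s : ℝ, ((a : ℝ) + s) / 3 = 1 / 3 * s + a / 3 := fun s => by ring
  simp only [h3]
  rw [h2, smul_smul]
  norm_num
  congr 1
  ring

theorem integral_comp_peanoFlip (b : Fin 3) (g : ℝ → ℂ) :
    ∫ u in (0 : ℝ)..1, g (peanoFlip b u) = ∫ u in (0 : ℝ)..1, g u := by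
  by_cases hb : b = 1
  · simp [peanoFlip, hb]
  · simp [peanoFlip, hb]

theorem abs_peanoFlip_sub (b : Fin 3) (u v : ℝ) : |peanoFlip b u - peanoFlip b v| = |u - v| := by
  unfold peanoFlip
  split_ifs
  · rw [sub_sub_sub_cancel_left, abs_sub_comm]
  · rfl

theorem continuous_peanoFlip (b : Fin 3) : Continuous (peanoFlip b) := by
  unfold peanoFlip
  split_ifs <;> fun_prop

theorem IsPeanoX.integral_comp_eq_sum {x : ℝ → ℝ} (hx : IsPeanoX x) {g : ℝ → ℂ}
    (hg : Continuous g) :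
    ∫ s in (0 : ℝ)..1, g (x s) = (1 / 9 : ℝ) • ∑ a : Fin 3, ∑ b : Fin 3,
      ∫ s in (0 : ℝ)..1, g ((a + peanoFlip b (x s)) / 3) := by
  have hthird : ∀ (a : Fin 3), ∀ s ∈ Set.Icc (0 : ℝ) 1, ((a : ℝ) + s) / 3 ∈ Set.Icc (0 : ℝ) 1 := by
    intro a s hs
    have ha : (a : ℝ) + 1 ≤ 3 := by exact_mod_cast a.isLt
    have h0 : (0 : ℝ) ≤ a := by positivity
    constructor <;> linarith [hs.1, hs.2]
  have hgx : ContinuousOn (fun s => g (x s)) (Set.Icc 0 1) := hg.comp_continuousOn hx.continuousOn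
  rw [integral_unit_eq_sum_thirds hgx]
  have hinner : ∀ a : Fin 3, ∫ s in (0 : ℝ)..1, g (x ((a + s) / 3)) =
      (1 / 3 : ℝ) • ∑ b : Fin 3, ∫ s in (0 : ℝ)..1, g ((a + peanoFlip b (x s)) / 3) := by
    intro a
    rw [integral_unit_eq_sum_thirds (f := fun s => g (x ((a + s) / 3)))
      (hgx.comp (by fun_prop) (hthird a))]
    congr 1
    refine Finset.sum_congr rfl fun b _ => intervalIntegral.integral_congr fun s hs => ?_
    rw [Set.uIcc_of_le zero_le_one] at hs
    simp only [hx.self_similar a b hs]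
  simp only [hinner]
  rw [← Finset.smul_sum, smul_smul]
  norm_num

theorem integral_eq_sum_peanoFlip {g : ℝ → ℂ} (hg : Continuous g) :
    ∫ u in (0 : ℝ)..1, g u = (1 / 9 : ℝ) • ∑ a : Fin 3, ∑ b : Fin 3,
      ∫ u in (0 : ℝ)..1, g ((a + peanoFlip b u) / 3) := by
  have h : ∀ a b : Fin 3, ∫ u in (0 : ℝ)..1, g ((a + peanoFlip b u) / 3) =
      ∫ u in (0 : ℝ)..1, g ((a + u) / 3) := fun a b =>
    integral_comp_peanoFlip b fun u => g ((a + u) / 3)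
  simp only [h]
  rw [integral_unit_eq_sum_thirds hg.continuousOn]
  simp only [Finset.sum_const, Finset.card_univ, Fintype.card_fin, ← Finset.smul_sum]
  rw [← Nat.cast_smul_eq_nsmul ℝ, smul_smul]
  norm_num

theorem IsPeanoX.norm_integral_comp_sub_le {x : ℝ → ℝ} (hx : IsPeanoX x) (n : ℕ) :
    ∀ {g : ℝ → ℂ} {K : ℝ}, Continuous g → (∀ u v, ‖g u - g v‖ ≤ K * |u - v|) →
      ‖(∫ s in (0 : ℝ)..1, g (x s)) - ∫ u in (0 : ℝ)..1, g u‖ ≤ K / 3 ^ n := by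
  induction n with
  | zero =>
    intro g K hg hK
    have hK0 : 0 ≤ K := by simpa using (norm_nonneg _).trans (hK 1 0)
    rw [← intervalIntegral.integral_sub
      (ContinuousOn.intervalIntegrable (by
        rw [Set.uIcc_of_le zero_le_one]; exact hg.comp_continuousOn hx.continuousOn))
      (hg.intervalIntegrable _ _)]
    refine (intervalIntegral.norm_integral_le_of_norm_le_const (C := K) fun s hs => ?_).trans
      (by simp)
    rw [Set.uIoc_of_le zero_le_one] at hs
    have hs' := Set.Ioc_subset_Icc_self hs
    have hxs := hx.mem_Icc hs'
    refine (hK _ _).trans (mul_le_of_le_one_right hK0 (abs_le.2 ⟨?_, ?_⟩)) <;>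
      linarith [hxs.1, hxs.2, hs'.1, hs'.2]
  | succ n ih =>
    intro g K hg hK
    rw [hx.integral_comp_eq_sum hg, integral_eq_sum_peanoFlip hg, ← smul_sub,
      ← Finset.sum_sub_distrib, norm_smul]
    simp only [← Finset.sum_sub_distrib]
    have hterm : ∀ a b : Fin 3,
        ‖(∫ s in (0 : ℝ)..1, g ((a + peanoFlip b (x s)) / 3)) -
          ∫ u in (0 : ℝ)..1, g ((a + peanoFlip b u) / 3)‖ ≤ K / 3 / 3 ^ n := by
      intro a b
      refine ih (g := fun u => g ((a + peanoFlip b u) / 3)) ?_ fun u v => (hK _ _).trans_eq ?_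
      · have := continuous_peanoFlip b
        fun_prop
      · rw [← sub_div, add_sub_add_left_eq_sub, abs_div, abs_peanoFlip_sub,
          abs_of_pos (three_pos (α := ℝ))]
        ring
    calc _ ≤ ‖(1 / 9 : ℝ)‖ * ∑ a : Fin 3, ∑ b : Fin 3, K / 3 / 3 ^ n := by
          gcongr
          refine (norm_sum_le _ _).trans (Finset.sum_le_sum fun a _ => ?_)
          exact (norm_sum_le _ _).trans (Finset.sum_le_sum fun b _ => hterm a b)
      _ = K / 3 ^ (n + 1) := by
          simp
          ring

theorem IsPeanoX.integral_comp_eq {x : ℝ → ℝ} (hx : IsPeanoX x) {g : ℝ → ℂ} {K : ℝ}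
    (hg : Continuous g) (hK : ∀ u v, ‖g u - g v‖ ≤ K * |u - v|) :
    ∫ s in (0 : ℝ)..1, g (x s) = ∫ u in (0 : ℝ)..1, g u := by
  rw [← sub_eq_zero, ← norm_le_zero_iff]
  have hlim : Tendsto (fun n : ℕ => K / 3 ^ n) atTop (nhds 0) :=
    tendsto_const_nhds.div_atTop (tendsto_pow_atTop_atTop_of_one_lt (by norm_num))
  exact ge_of_tendsto' hlim fun n => hx.norm_integral_comp_sub_le n hg hK

theorem IsPeanoX.aemeasurable {x : ℝ → ℝ} (hx : IsPeanoX x) :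
    AEMeasurable x (MeasureTheory.volume.restrict (Set.Ioc 0 1)) :=
  (hx.continuousOn.mono Set.Ioc_subset_Icc_self).aemeasurable measurableSet_Ioc

/-- The horizontal component of the Peano curve preserves Lebesgue measure on the unit interval. -/
theorem IsPeanoX.map_restrict_Ioc {x : ℝ → ℝ} (hx : IsPeanoX x) :
    (MeasureTheory.volume.restrict (Set.Ioc (0 : ℝ) 1)).map x =
      MeasureTheory.volume.restrict (Set.Ioc (0 : ℝ) 1) := by
  refine MeasureTheory.Measure.ext_of_charFun (funext fun ξ => ?_)
  have hcont : Continuous fun u : ℝ => Complex.exp (ξ * u * Complex.I) := by fun_prop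
  rw [MeasureTheory.charFun_apply_real, MeasureTheory.charFun_apply_real,
    MeasureTheory.integral_map hx.aemeasurable hcont.aestronglyMeasurable,
    ← intervalIntegral.integral_of_le zero_le_one, ← intervalIntegral.integral_of_le zero_le_one]
  refine hx.integral_comp_eq (g := fun u => Complex.exp (ξ * u * Complex.I)) (K := |ξ|) hcont
    fun u v => ?_
  have hsplit : Complex.exp (ξ * u * Complex.I) - Complex.exp (ξ * v * Complex.I) =
      Complex.exp (Complex.I * (ξ * v : ℝ)) *
        (Complex.exp (Complex.I * (ξ * (u - v) : ℝ)) - 1) := by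
    rw [mul_sub, ← Complex.exp_add, mul_one]
    push_cast
    ring_nf
  rw [hsplit, norm_mul, Complex.norm_exp_I_mul_ofReal, one_mul, ← abs_mul]
  exact Real.norm_exp_I_mul_ofReal_sub_one_le

/-- The horizontal component of the Peano curve possesses a local time (density of its
occupation measure) with respect to Lebesgue measure, attaining values no greater than `1`. -/
theorem peano_local_time (x : ℝ → ℝ) (hx : IsPeanoX x) :
    ∃ L : ℝ → ℝ → ℝ,
      (∀ t ∈ Set.Icc (0 : ℝ) 1, ∀ z : ℝ, L t z ∈ Set.Icc (0 : ℝ) 1) ∧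
      (∀ t ∈ Set.Icc (0 : ℝ) 1, Measurable (L t)) ∧
      (∀ t ∈ Set.Icc (0 : ℝ) 1, ∀ g : ℝ → ℝ, Measurable g → (∃ C : ℝ, ∀ z, |g z| ≤ C) →
        ∫ s in (0 : ℝ)..t, g (x s) = ∫ z : ℝ, g z * L t z) := by
  have hle : ∀ t ∈ Set.Icc (0 : ℝ) 1,
      MeasureTheory.volume.restrict (Set.Ioc 0 t) ≤ MeasureTheory.volume.restrict (Set.Ioc 0 1) :=
    fun t ht => MeasureTheory.Measure.restrict_mono (Set.Ioc_subset_Ioc_right ht.2) le_rfl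
  let occ : ℝ → MeasureTheory.Measure ℝ := fun t =>
    (MeasureTheory.volume.restrict (Set.Ioc 0 t)).map x
  have hocc : ∀ t ∈ Set.Icc (0 : ℝ) 1, occ t ≤ MeasureTheory.volume := fun t ht =>
    ((MeasureTheory.Measure.map_mono_of_aemeasurable (hle t ht) hx.aemeasurable).trans_eq
      hx.map_restrict_Ioc).trans MeasureTheory.Measure.restrict_le_self
  refine ⟨fun t z => min ((occ t).rnDeriv MeasureTheory.volume z).toReal 1,
    fun t _ z => ⟨le_min ENNReal.toReal_nonneg zero_le_one, min_le_right _ _⟩,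
    fun t _ => (MeasureTheory.Measure.measurable_rnDeriv _ _).ennreal_toReal.min measurable_const,
    fun t ht g hg _ => ?_⟩
  have hxt : AEMeasurable x (MeasureTheory.volume.restrict (Set.Ioc 0 t)) :=
    hx.aemeasurable.mono_measure (hle t ht)
  rw [intervalIntegral.integral_of_le ht.1,
    ← MeasureTheory.integral_map hxt hg.aestronglyMeasurable,
    ← MeasureTheory.integral_rnDeriv_smul
      (MeasureTheory.Measure.absolutelyContinuous_of_le (hocc t ht))]
  refine MeasureTheory.integral_congr_ae ?_
  filter_upwards [MeasureTheory.Measure.rnDeriv_le_one_of_le (hocc t ht)] with z hz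
  have hz1 : ((occ t).rnDeriv MeasureTheory.volume z).toReal ≤ 1 := by
    simpa using ENNReal.toReal_mono ENNReal.one_ne_top hz
  rw [min_eq_left hz1, smul_eq_mul, mul_comm]
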